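/- With Φ the fundamental solution as above, suppose φ₁₂(a,b)=0 for some a<b in I. Then for every a' ∈ (m,a) there exists b' ∈ [a,b) with φ₁₂(a',b') = 0; and for every b' ∈ (b,M) there exists a' ∈ (a,b] with φ₁₂(a',b') = 0. -/

import Mathlib

open MeasureTheory Set

/-- An a priori bound for `p' = q`, `q' = R p - A q` on an interval where the coefficients have small
integral. -/
lemma abs_add_abs_le_of_integral_le_half {R A p q : ℝ → ℝ} {d c : ℝ}
    (hR : IntervalIntegrable R volume d c) (hA : IntervalIntegrable A volume d c)
    (hp : ContinuousOn p (Ico d c)) (hq : ContinuousOn q (Ico d c))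
    (hsmall : ∫ t in d..c, (1 + |R t| + |A t|) ≤ 1 / 2)
    (hpi : ∀ y ∈ Ico d c, p y = p d + ∫ t in d..y, q t)
    (hqi : ∀ y ∈ Ico d c, q y = q d + ∫ t in d..y, (R t * p t - A t * q t)) :
    ∀ y ∈ Ico d c, |p y| + |q y| ≤ 2 * (|p d| + |q d|) := by
  intro y hy
  have hsub : Icc d y ⊆ Ico d c := fun t ht => ⟨ht.1, ht.2.trans_lt hy.2⟩
  have hk : IntervalIntegrable (fun t => 1 + |R t| + |A t|) volume d c :=
    (intervalIntegrable_const.add hR.abs).add hA.abs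
  obtain ⟨z, hz, hmax⟩ := isCompact_Icc.exists_isMaxOn (nonempty_Icc.2 hy.1)
    ((hp.mono hsub).abs.add (hq.mono hsub).abs)
  set N := |p z| + |q z| with hN
  have hmax' : ∀ t ∈ Icc d y, |p t| + |q t| ≤ N := fun t ht => hmax ht
  have hdz : d ≤ z := hz.1
  have hzc : z ≤ c := (hsub hz).2.le
  have hk' : IntervalIntegrable (fun t => 1 + |R t| + |A t|) volume d z :=
    hk.mono_set (by rw [uIcc_of_le hdz, uIcc_of_le (hdz.trans hzc)]; exact Icc_subset_Icc_right hzc)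
  have hR' : IntervalIntegrable R volume d z :=
    hR.mono_set (by rw [uIcc_of_le hdz, uIcc_of_le (hdz.trans hzc)]; exact Icc_subset_Icc_right hzc)
  have hA' : IntervalIntegrable A volume d z :=
    hA.mono_set (by rw [uIcc_of_le hdz, uIcc_of_le (hdz.trans hzc)]; exact Icc_subset_Icc_right hzc)
  have hpb : |∫ t in d..z, q t| ≤ ∫ t in d..z, 1 * N := by
    refine intervalIntegral.norm_integral_le_of_norm_le (f := q) hdz
      (Filter.Eventually.of_forall fun t ht => ?_) intervalIntegrable_const
    rw [Real.norm_eq_abs, one_mul]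
    linarith [hmax' t ⟨ht.1.le, ht.2.trans hz.2⟩, abs_nonneg (p t)]
  have hqb : |∫ t in d..z, (R t * p t - A t * q t)| ≤ ∫ t in d..z, (|R t| + |A t|) * N := by
    refine intervalIntegral.norm_integral_le_of_norm_le
      (f := fun t => R t * p t - A t * q t) hdz
      (Filter.Eventually.of_forall fun t ht => ?_) ((hR'.abs.add hA'.abs).mul_const N)
    have hb := hmax' t ⟨ht.1.le, ht.2.trans hz.2⟩
    calc ‖R t * p t - A t * q t‖ ≤ |R t * p t| + |A t * q t| := abs_sub _ _
      _ = |R t| * |p t| + |A t| * |q t| := by rw [abs_mul, abs_mul]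
      _ ≤ |R t| * N + |A t| * N := by
        gcongr
        · linarith [abs_nonneg (q t)]
        · linarith [abs_nonneg (p t)]
      _ = _ := by ring
  have hsum : (∫ t in d..z, 1 * N) + ∫ t in d..z, (|R t| + |A t|) * N
      = (∫ t in d..z, (1 + |R t| + |A t|)) * N := by
    rw [← intervalIntegral.integral_add intervalIntegrable_const
      ((hR'.abs.add hA'.abs).mul_const N), ← intervalIntegral.integral_mul_const]
    exact intervalIntegral.integral_congr fun t _ => by ring
  have hmono : ∫ t in d..z, (1 + |R t| + |A t|) ≤ 1 / 2 := by
    refine le_trans (intervalIntegral.integral_mono_interval le_rfl hdz hzc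
      (Filter.Eventually.of_forall fun t => ?_) hk) hsmall
    simp only [Pi.zero_apply]
    positivity
  have hN0 : 0 ≤ N := by positivity
  have h1 := abs_add_le (p d) (∫ t in d..z, q t)
  have h2 := abs_add_le (q d) (∫ t in d..z, (R t * p t - A t * q t))
  rw [← hpi z (hsub hz)] at h1
  rw [← hqi z (hsub hz)] at h2
  have h3 := mul_le_mul_of_nonneg_right hmono hN0
  have h4 := hmax' y ⟨hy.1, le_rfl⟩
  linarith

/-- The integral equations alone, with no regularity assumed on `p` and `q`, force the right-hand
side to be integrable. -/
lemma intervalIntegrable_rhs_of_le {R A p q : ℝ → ℝ} {p₀ q₀ x b : ℝ} (hxb : x ≤ b)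
    (hR : IntervalIntegrable R volume x b) (hA : IntervalIntegrable A volume x b)
    (hp : ∀ y ∈ Icc x b, p y = p₀ + ∫ t in x..y, q t)
    (hq : ∀ y ∈ Icc x b, q y = q₀ + ∫ t in x..y, (R t * p t - A t * q t)) :
    IntervalIntegrable (fun t => R t * p t - A t * q t) volume x b := by
  set g : ℝ → ℝ := fun t => R t * p t - A t * q t with hg
  have mono {f : ℝ → ℝ} {u v u' v' : ℝ} (h1 : u ≤ u') (h2 : u' ≤ v') (h3 : v' ≤ v)
      (hf : IntervalIntegrable f volume u v) : IntervalIntegrable f volume u' v' :=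
    hf.mono_set (by
      rw [uIcc_of_le h2, uIcc_of_le (h1.trans (h2.trans h3))]; exact Icc_subset_Icc h1 h3)
  -- where `g` is integrable, both equations are genuine
  have contq : ∀ y ∈ Icc x b, IntervalIntegrable g volume x y → ContinuousOn q (Icc x y) := by
    intro y hy hgy
    have := intervalIntegral.continuousOn_primitive_interval' hgy left_mem_uIcc
    rw [uIcc_of_le hy.1] at this
    exact (continuousOn_const.add this).congr fun t ht => hq t ⟨ht.1, ht.2.trans hy.2⟩
  have contp : ∀ y ∈ Icc x b, IntervalIntegrable q volume x y → ContinuousOn p (Icc x y) := by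
    intro y hy hqy
    have := intervalIntegral.continuousOn_primitive_interval' hqy left_mem_uIcc
    rw [uIcc_of_le hy.1] at this
    exact (continuousOn_const.add this).congr fun t ht => hp t ⟨ht.1, ht.2.trans hy.2⟩
  set S : Set ℝ := {y ∈ Icc x b | IntervalIntegrable g volume x y} with hS
  have hxS : x ∈ S := ⟨left_mem_Icc.2 hxb, by simp⟩
  have hSb : BddAbove S := ⟨b, fun y hy => hy.1.2⟩
  set c := sSup S with hc
  have hxc : x ≤ c := le_csSup hSb hxS
  have hcb : c ≤ b := csSup_le ⟨x, hxS⟩ fun y hy => hy.1.2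
  have hlt : ∀ y ∈ Ico x c, IntervalIntegrable g volume x y := by
    intro y hy
    obtain ⟨s, hs, hys⟩ := exists_lt_of_lt_csSup ⟨x, hxS⟩ hy.2
    exact mono le_rfl hy.1 hys.le hs.2
  have hcS : IntervalIntegrable g volume x c := by
    rcases hxc.eq_or_lt with h | hxc'
    · rw [← h]
    have hk : IntervalIntegrable (fun t => 1 + |R t| + |A t|) volume x c :=
      (intervalIntegrable_const.add (mono le_rfl hxc hcb hR).abs).add (mono le_rfl hxc hcb hA).abs
    have hcont := intervalIntegral.continuousOn_primitive_interval' hk right_mem_uIcc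
    rw [uIcc_of_le hxc] at hcont
    have hev : ∀ᶠ d in nhdsWithin c (Iio c),
        -(1 / 2) < ∫ t in c..d, (1 + |R t| + |A t|) := by
      have h1 := (hcont c (right_mem_Icc.2 hxc)).mono_left
        (nhdsWithin_mono c (Ico_subset_Icc_self : Ico x c ⊆ Icc x c))
      rw [nhdsWithin_Ico_eq_nhdsLT hxc'] at h1
      exact h1.eventually_const_lt (by simp)
    obtain ⟨d, hd1, hd⟩ := (hev.and (Ico_mem_nhdsLT hxc')).exists
    rw [intervalIntegral.integral_symm] at hd1
    have hIco : ∀ y ∈ Ico x c, ContinuousOn q (Icc x y) ∧ ContinuousOn p (Icc x y) := by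
      intro y hy
      have hyb : y ∈ Icc x b := ⟨hy.1, hy.2.le.trans hcb⟩
      have := contq y hyb (hlt y hy)
      exact ⟨this, contp y hyb (ContinuousOn.intervalIntegrable_of_Icc hy.1 this)⟩
    have glue {f : ℝ → ℝ} (hf : ∀ y ∈ Ico x c, ContinuousOn f (Icc x y)) :
        ContinuousOn f (Ico d c) := by
      intro t ht
      obtain ⟨s, hs⟩ := exists_between ht.2
      have hxt : x ≤ t := hd.1.trans ht.1
      refine ((hf s ⟨hxt.trans hs.1.le, hs.2⟩) t ⟨hxt, hs.1.le⟩).mono_of_mem_nhdsWithin ?_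
      have : Iio s ∈ nhds t := Iio_mem_nhds hs.1
      filter_upwards [mem_nhdsWithin_of_mem_nhds this, self_mem_nhdsWithin] with u hu hu'
      exact ⟨hd.1.trans hu'.1, le_of_lt hu⟩
    have hqc : ContinuousOn q (Ico d c) := glue fun y hy => (hIco y hy).1
    have hpc : ContinuousOn p (Ico d c) := glue fun y hy => (hIco y hy).2
    have hRd := mono hd.1 hd.2.le hcb hR
    have hAd := mono hd.1 hd.2.le hcb hA
    have hdb : d ∈ Icc x b := ⟨hd.1, hd.2.le.trans hcb⟩
    have bound := abs_add_abs_le_of_integral_le_half hRd hAd hpc hqc (by linarith)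
      (fun y hy => by
        have hxy : y ∈ Ico x c := ⟨hd.1.trans hy.1, hy.2⟩
        have hi := ContinuousOn.intervalIntegrable_of_Icc (μ := volume) hxy.1 (hIco y hxy).1
        rw [hp y ⟨hxy.1, hxy.2.le.trans hcb⟩, hp d hdb, add_assoc,
          intervalIntegral.integral_add_adjacent_intervals (mono le_rfl hd.1 hy.1 hi)
            (mono hd.1 hy.1 le_rfl hi)])
      (fun y hy => by
        have hxy : y ∈ Ico x c := ⟨hd.1.trans hy.1, hy.2⟩
        have hi := hlt y hxy
        rw [hq y ⟨hxy.1, hxy.2.le.trans hcb⟩, hq d hdb, add_assoc,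
          intervalIntegral.integral_add_adjacent_intervals (mono le_rfl hd.1 hy.1 hi)
            (mono hd.1 hy.1 le_rfl hi)])
    refine (hlt d hd).trans ?_
    rw [intervalIntegrable_iff_integrableOn_Ico_of_le hd.2.le] at hRd hAd ⊢
    exact (hRd.mul_bdd (c := 2 * (|p d| + |q d|)) (hpc.aestronglyMeasurable measurableSet_Ico)
        ((ae_restrict_iff' measurableSet_Ico).2 (Filter.Eventually.of_forall fun t ht => by
          rw [Real.norm_eq_abs]; linarith [bound t ht, abs_nonneg (q t)]))).sub
      (hAd.mul_bdd (c := 2 * (|p d| + |q d|)) (hqc.aestronglyMeasurable measurableSet_Ico)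
        ((ae_restrict_iff' measurableSet_Ico).2 (Filter.Eventually.of_forall fun t ht => by
          rw [Real.norm_eq_abs]; linarith [bound t ht, abs_nonneg (p t)])))
  rcases hcb.eq_or_lt with h | hcb'
  · rwa [← h]
  exfalso
  have hq1 : ∀ y ∈ Ioc c b, q y = q₀ := by
    intro y hy
    have hyb : y ∈ Icc x b := ⟨hxc.trans hy.1.le, hy.2⟩
    rw [hq y hyb, intervalIntegral.integral_undef, add_zero]
    exact fun h => hy.1.not_ge (le_csSup hSb ⟨hyb, h⟩)
  have hqcb : IntervalIntegrable q volume c b :=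
    (intervalIntegrable_const (c := q₀)).congr (by
      rw [uIoc_of_le hcb]; exact fun t ht => (hq1 t ht).symm)
  have hqxc : IntervalIntegrable q volume x c :=
    ContinuousOn.intervalIntegrable_of_Icc hxc (contq c ⟨hxc, hcb⟩ hcS)
  have hpcont := contp b (right_mem_Icc.2 hxb) (hqxc.trans hqcb)
  have hgcb : IntervalIntegrable g volume c b := by
    have h1 : IntervalIntegrable (fun t => R t * p t - A t * q₀) volume c b := by
      refine ((mono hxc hcb le_rfl hR).mul_continuousOn ?_).sub
        ((mono hxc hcb le_rfl hA).mul_const q₀)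
      rw [uIcc_of_le hcb]
      exact hpcont.mono (Icc_subset_Icc_left hxc)
    refine h1.congr ?_
    rw [uIoc_of_le hcb]
    intro t ht
    simp only [hg, hq1 t ht]
  exact hcb'.not_ge (le_csSup hSb ⟨right_mem_Icc.2 hxb, hcS.trans hgcb⟩)

lemma intervalIntegrable_rhs {R A p q : ℝ → ℝ} {p₀ q₀ x b : ℝ}
    (hR : IntervalIntegrable R volume x b) (hA : IntervalIntegrable A volume x b)
    (hp : ∀ y ∈ uIcc x b, p y = p₀ + ∫ t in x..y, q t)
    (hq : ∀ y ∈ uIcc x b, q y = q₀ + ∫ t in x..y, (R t * p t - A t * q t)) :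
    IntervalIntegrable (fun t => R t * p t - A t * q t) volume x b := by
  rcases le_total x b with hxb | hbx
  · rw [uIcc_of_le hxb] at hp hq
    exact intervalIntegrable_rhs_of_le hxb hR hA hp hq
  · rw [uIcc_of_ge hbx] at hp hq
    have hmem : ∀ y ∈ Icc (-x) (-b), -y ∈ Icc b x := fun y hy =>
      ⟨by linarith [hy.2], by linarith [hy.1]⟩
    have key := intervalIntegrable_rhs_of_le (R := fun t => R (-t)) (A := fun t => -A (-t))
      (p := fun t => -p (-t)) (q := fun t => q (-t)) (p₀ := -p₀) (q₀ := q₀)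
      (neg_le_neg hbx) ((IntervalIntegrable.iff_comp_neg (by simp)).1 hR)
      ((IntervalIntegrable.iff_comp_neg (by simp)).1 hA).neg
      (fun y hy => by
        rw [hp _ (hmem y hy), intervalIntegral.integral_comp_neg, neg_neg,
          intervalIntegral.integral_symm x (-y)]
        ring)
      (fun y hy => by
        have h : ∀ t, R (-t) * -p (-t) - -A (-t) * q (-t)
            = -(fun s => R s * p s - A s * q s) (-t) := fun t => by ring
        simp only [h]
        rw [hq _ (hmem y hy), intervalIntegral.integral_neg,
          intervalIntegral.integral_comp_neg (fun s => R s * p s - A s * q s), neg_neg,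
          intervalIntegral.integral_symm x (-y), neg_neg])
    have h : ∀ t, -(R t * -p t - -A t * q t) = R t * p t - A t * q t := fun t => by ring
    simpa only [neg_neg, Pi.neg_def, h] using ((IntervalIntegrable.iff_comp_neg (by simp)).1 key).neg

/-- `(p, q)` is a Carathéodory solution on `I` of the system `p' = q`, `q' = R p - A q`. -/
structure IsCaratheodorySolOn (I : Set ℝ) (R A p q : ℝ → ℝ) : Prop where
  intervalIntegrable : ∀ y ∈ I, ∀ z ∈ I,
    IntervalIntegrable (fun t => R t * p t - A t * q t) volume y z
  continuousOn : ContinuousOn q I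
  fst_sub : ∀ y ∈ I, ∀ z ∈ I, p z - p y = ∫ t in y..z, q t
  snd_sub : ∀ y ∈ I, ∀ z ∈ I, q z - q y = ∫ t in y..z, (R t * p t - A t * q t)

lemma continuousOn_of_integral_eq {I : Set ℝ} (hI : IsOpen I) {f g : ℝ → ℝ}
    (hg : ∀ y ∈ I, ∀ z ∈ I, IntervalIntegrable g volume y z)
    (hf : ∀ y ∈ I, ∀ z ∈ I, f z - f y = ∫ t in y..z, g t) : ContinuousOn f I := by
  intro y hy
  obtain ⟨u, v, hyuv, hsub, huv⟩ : ∃ u v, y ∈ Ioo u v ∧ u ∈ I ∧ v ∈ I := by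
    obtain ⟨ε, hε, h⟩ := Metric.isOpen_iff.1 hI y hy
    refine ⟨y - ε / 2, y + ε / 2, ⟨by linarith, by linarith⟩, h ?_, h ?_⟩ <;>
      · rw [Metric.mem_ball, Real.dist_eq]
        rw [abs_lt]
        constructor <;> linarith
  have h1 := intervalIntegral.continuousOn_primitive_interval' (hg u hsub v huv)
    left_mem_uIcc
  have h2 := (h1.mono (Ioo_subset_Icc_self.trans Icc_subset_uIcc)).continuousAt
    (Ioo_mem_nhds hyuv.1 hyuv.2)
  refine ContinuousAt.continuousWithinAt ?_
  refine (h2.const_add (f u)).congr ?_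
  filter_upwards [hI.mem_nhds hy] with z hz
  rw [← hf u hsub z hz]
  ring

lemma isCaratheodorySolOn_of_base {I : Set ℝ} (hI : IsOpen I) (hIc : I.OrdConnected)
    {R A p q : ℝ → ℝ} {p₀ q₀ x : ℝ} (hx : x ∈ I)
    (hR : ∀ y ∈ I, ∀ z ∈ I, IntervalIntegrable R volume y z)
    (hA : ∀ y ∈ I, ∀ z ∈ I, IntervalIntegrable A volume y z)
    (hp : ∀ y ∈ I, p y = p₀ + ∫ t in x..y, q t)
    (hq : ∀ y ∈ I, q y = q₀ + ∫ t in x..y, (R t * p t - A t * q t)) :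
    IsCaratheodorySolOn I R A p q := by
  have hbase : ∀ y ∈ I, IntervalIntegrable (fun t => R t * p t - A t * q t) volume x y :=
    fun y hy => intervalIntegrable_rhs (hR x hx y hy) (hA x hx y hy)
      (fun t ht => hp t (hIc.uIcc_subset hx hy ht)) (fun t ht => hq t (hIc.uIcc_subset hx hy ht))
  have hint : ∀ y ∈ I, ∀ z ∈ I,
      IntervalIntegrable (fun t => R t * p t - A t * q t) volume y z :=
    fun y hy z hz => (hbase y hy).symm.trans (hbase z hz)
  have hsnd : ∀ y ∈ I, ∀ z ∈ I, q z - q y = ∫ t in y..z, (R t * p t - A t * q t) := by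
    intro y hy z hz
    rw [← intervalIntegral.integral_interval_sub_left (hbase z hz) (hbase y hy), hq z hz, hq y hy]
    ring
  have hcont := continuousOn_of_integral_eq hI hint hsnd
  have hqi : ∀ y ∈ I, ∀ z ∈ I, IntervalIntegrable q volume y z := fun y hy z hz =>
    (hcont.mono (hIc.uIcc_subset hy hz)).intervalIntegrable
  refine ⟨hint, hcont, fun y hy z hz => ?_, hsnd⟩
  rw [← intervalIntegral.integral_interval_sub_left (hqi x hx z hz) (hqi x hx y hy), hp z hz,
    hp y hy]
  ring

lemma AbsolutelyContinuousOnInterval.lipschitzOnWith_comp {f g : ℝ → ℝ} {s : Set ℝ} {K : NNReal}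
    {a b : ℝ} (hg : LipschitzOnWith K g s) (hf : AbsolutelyContinuousOnInterval f a b)
    (hmaps : MapsTo f (uIcc a b) s) : AbsolutelyContinuousOnInterval (fun x => g (f x)) a b := by
  rw [absolutelyContinuousOnInterval_iff] at hf ⊢
  intro ε hε
  obtain ⟨δ, hδ, h⟩ := hf (ε / (K + 1)) (by positivity)
  refine ⟨δ, hδ, fun E hE hlt => ?_⟩
  have h1 := h E hE hlt
  rw [lt_div_iff₀ (by positivity)] at h1
  refine lt_of_le_of_lt ?_ h1
  rw [Finset.sum_mul]
  refine Finset.sum_le_sum fun i hi => ?_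
  obtain ⟨hi1, hi2⟩ := hE.1 i hi
  refine (hg.dist_le_mul _ (hmaps hi1) _ (hmaps hi2)).trans ?_
  rw [mul_comm]
  gcongr
  linarith

lemma AbsolutelyContinuousOnInterval.exp {f : ℝ → ℝ} {a b : ℝ}
    (hf : AbsolutelyContinuousOnInterval f a b) :
    AbsolutelyContinuousOnInterval (fun x => Real.exp (f x)) a b := by
  obtain ⟨C, hC⟩ := hf.exists_bound
  have hlip : LipschitzOnWith (Real.exp C).toNNReal Real.exp (Iic C) := by
    refine (convex_Iic C).lipschitzOnWith_of_nnnorm_deriv_le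
      (fun x _ => Real.differentiableAt_exp) fun x hx => ?_
    rw [Real.deriv_exp, ← NNReal.coe_le_coe, coe_nnnorm, Real.norm_eq_abs, Real.abs_exp,
      Real.coe_toNNReal _ (Real.exp_pos C).le]
    exact Real.exp_le_exp.2 hx
  exact AbsolutelyContinuousOnInterval.lipschitzOnWith_comp hlip hf fun x hx =>
    (le_abs_self _).trans (hC x hx)

namespace IsCaratheodorySolOn

variable {I : Set ℝ} {R A p q p₁ q₁ p₂ q₂ : ℝ → ℝ}

lemma intervalIntegrable_snd (hIc : I.OrdConnected) (h : IsCaratheodorySolOn I R A p q) :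
    ∀ y ∈ I, ∀ z ∈ I, IntervalIntegrable q volume y z := fun _ hy _ hz =>
  (h.continuousOn.mono (hIc.uIcc_subset hy hz)).intervalIntegrable

lemma hasDerivAt_fst (hI : IsOpen I) (hIc : I.OrdConnected)
    (h : IsCaratheodorySolOn I R A p q) {y : ℝ} (hy : y ∈ I) : HasDerivAt p (q y) y := by
  have h1 := intervalIntegral.integral_hasDerivAt_right
    (h.intervalIntegrable_snd hIc y hy y hy)
    (h.continuousOn.stronglyMeasurableAtFilter hI y hy)
    (h.continuousOn.continuousAt (hI.mem_nhds hy))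
  refine (h1.const_add (p y)).congr_of_eventuallyEq ?_
  filter_upwards [hI.mem_nhds hy] with z hz
  rw [← h.fst_sub y hy z hz]
  ring

/-- A Wronskian of two solutions that vanishes at one point vanishes everywhere. -/
lemma wronskian_eq_zero (hIc : I.OrdConnected)
    (hA : ∀ y ∈ I, ∀ z ∈ I, IntervalIntegrable A volume y z)
    (h₁ : IsCaratheodorySolOn I R A p₁ q₁) (h₂ : IsCaratheodorySolOn I R A p₂ q₂)
    {y z : ℝ} (hy : y ∈ I) (hz : z ∈ I) (h : p₁ y * q₂ y - q₁ y * p₂ y = 0) :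
    p₁ z * q₂ z - q₁ z * p₂ z = 0 := by
  have hac (c : ℝ) {f : ℝ → ℝ} (hf : IntervalIntegrable f volume y z) :
      AbsolutelyContinuousOnInterval (fun t => c + ∫ s in y..t, f s) y z :=
    (((LipschitzWith.const c).lipschitzOnWith).absolutelyContinuousOnInterval).fun_add
      (hf.absolutelyContinuousOnInterval_intervalIntegral left_mem_uIcc)
  have hq₁ := h₁.intervalIntegrable_snd hIc y hy z hz
  have hq₂ := h₂.intervalIntegrable_snd hIc y hy z hz
  have hg₁ := h₁.intervalIntegrable y hy z hz
  have hg₂ := h₂.intervalIntegrable y hy z hz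
  have hV := (((hac (p₁ y) hq₁).fun_mul (hac (q₂ y) hg₂)).fun_sub
    ((hac (q₁ y) hg₁).fun_mul (hac (p₂ y) hq₂))).fun_mul (hac 0 (hA y hy z hz)).exp
  obtain ⟨C, hC⟩ := hV.const_of_ae_hasDerivAt_zero (by
    filter_upwards [hq₁.ae_hasDerivAt_integral, hq₂.ae_hasDerivAt_integral,
      hg₁.ae_hasDerivAt_integral, hg₂.ae_hasDerivAt_integral,
      (hA y hy z hz).ae_hasDerivAt_integral] with t d₁ d₂ e₁ e₂ a ht
    have htI := hIc.uIcc_subset hy hz ht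
    refine (((((d₁ ht y left_mem_uIcc).const_add _).fun_mul
      ((e₂ ht y left_mem_uIcc).const_add _)).fun_sub
      (((e₁ ht y left_mem_uIcc).const_add _).fun_mul
      ((d₂ ht y left_mem_uIcc).const_add _))).fun_mul
      (((a ht y left_mem_uIcc).const_add 0).exp)).congr_deriv ?_
    rw [← h₁.fst_sub y hy t htI, ← h₁.snd_sub y hy t htI, ← h₂.fst_sub y hy t htI,
      ← h₂.snd_sub y hy t htI]
    ring)
  have hy' := hC y left_mem_uIcc
  have hz' := hC z right_mem_uIcc
  rw [← h₁.fst_sub y hy z hz, ← h₁.snd_sub y hy z hz, ← h₂.fst_sub y hy z hz,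
    ← h₂.snd_sub y hy z hz] at hz'
  simp only [intervalIntegral.integral_same, add_zero, h, zero_mul] at hy'
  rw [← hy', mul_eq_zero, or_iff_left (Real.exp_pos _).ne'] at hz'
  linear_combination hz'

/-- **Sturm separation**: if the first component of a solution vanishes at `a < b`, and that of
another solution has no zero in `[a, b]`, then their Wronskian vanishes. -/
lemma wronskian_eq_zero_of_forall_ne_zero (hI : IsOpen I) (hIc : I.OrdConnected)
    (hA : ∀ y ∈ I, ∀ z ∈ I, IntervalIntegrable A volume y z)
    (h₁ : IsCaratheodorySolOn I R A p₁ q₁) (h₂ : IsCaratheodorySolOn I R A p₂ q₂)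
    {a b : ℝ} (ha : a ∈ I) (hb : b ∈ I) (hab : a < b) (hpa : p₁ a = 0) (hpb : p₁ b = 0)
    (hne : ∀ t ∈ Icc a b, p₂ t ≠ 0) {z : ℝ} (hz : z ∈ I) :
    p₁ z * q₂ z - q₁ z * p₂ z = 0 := by
  have hsub : Icc a b ⊆ I := hIc.out ha hb
  have hd : ∀ t ∈ Icc a b, HasDerivAt (fun s => p₁ s / p₂ s)
      ((q₁ t * p₂ t - p₁ t * q₂ t) / p₂ t ^ 2) t := fun t ht =>
    (h₁.hasDerivAt_fst hI hIc (hsub ht)).fun_div (h₂.hasDerivAt_fst hI hIc (hsub ht)) (hne t ht)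
  obtain ⟨ξ, hξ, h0⟩ := exists_hasDerivAt_eq_zero hab
    (fun t ht => (hd t ht).continuousAt.continuousWithinAt) (by simp [hpa, hpb])
    (fun t ht => hd t (Ioo_subset_Icc_self ht))
  rw [div_eq_zero_iff, or_iff_left (pow_ne_zero 2 (hne ξ (Ioo_subset_Icc_self hξ)))] at h0
  exact h₁.wronskian_eq_zero hIc hA h₂ (hsub (Ioo_subset_Icc_self hξ)) hz (by linarith)

end IsCaratheodorySolOn


/-- Lemma "roots of φ₁₂": if φ₁₂(a,b) = 0 with a < b in I, then for every a' ∈ I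
with a' < a there is b' ∈ [a,b) with φ₁₂(a',b') = 0, and for every b' ∈ I with
b < b' there is a' ∈ (a,b] with φ₁₂(a',b') = 0. -/
theorem stmt_3
    (I : Set ℝ) (hI : IsOpen I) (hIconn : I.OrdConnected)
    (α r σ : ℝ → ℝ)
    (hmα : Measurable α) (hmr : Measurable r) (hmσ : Measurable σ)
    (hσpos : ∀ x ∈ I, 0 < σ x)
    (hint1 : MeasureTheory.LocallyIntegrableOn (fun z => 1 / (σ z) ^ 2) I)
    (hint2 : MeasureTheory.LocallyIntegrableOn (fun z => α z / (σ z) ^ 2) I)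
    (hint3 : MeasureTheory.LocallyIntegrableOn (fun z => r z / (σ z) ^ 2) I)
    (φ11 φ12 φ21 φ22 : ℝ → ℝ → ℝ)
    (hφ11 : ∀ x ∈ I, ∀ y ∈ I, φ11 x y = 1 + ∫ z in x..y, φ21 x z)
    (hφ12 : ∀ x ∈ I, ∀ y ∈ I, φ12 x y = ∫ z in x..y, φ22 x z)
    (hφ21 : ∀ x ∈ I, ∀ y ∈ I, φ21 x y =
      ∫ z in x..y, (2 * r z / (σ z) ^ 2 * φ11 x z - 2 * α z / (σ z) ^ 2 * φ21 x z))
    (hφ22 : ∀ x ∈ I, ∀ y ∈ I, φ22 x y = 1 +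
      ∫ z in x..y, (2 * r z / (σ z) ^ 2 * φ12 x z - 2 * α z / (σ z) ^ 2 * φ22 x z))
    (a b : ℝ) (ha : a ∈ I) (hb : b ∈ I) (hab : a < b)
    (h0 : φ12 a b = 0) :
    (∀ a' ∈ I, a' < a → ∃ b' ∈ Set.Ico a b, φ12 a' b' = 0) ∧
    (∀ b' ∈ I, b < b' → ∃ a' ∈ Set.Ioc a b, φ12 a' b' = 0) := by
  have hc {f : ℝ → ℝ} (hf : LocallyIntegrableOn (fun z => f z / (σ z) ^ 2) I) :
      ∀ y ∈ I, ∀ z ∈ I, IntervalIntegrable (fun z => 2 * f z / (σ z) ^ 2) volume y z := by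
    intro y hy z hz
    have h1 := ((hf.integrableOn_compact_subset (hIconn.uIcc_subset hy hz)
      isCompact_uIcc).intervalIntegrable).const_mul 2
    simpa only [mul_div_assoc] using h1
  have hA := hc hint2
  have sol : ∀ x ∈ I, IsCaratheodorySolOn I (fun z => 2 * r z / (σ z) ^ 2)
      (fun z => 2 * α z / (σ z) ^ 2) (φ12 x) (φ22 x) := fun x hx =>
    isCaratheodorySolOn_of_base hI hIconn hx (hc hint3) hA (p₀ := 0)
      (fun y hy => by rw [zero_add]; exact hφ12 x hx y hy) (hφ22 x hx)
  have h12 : ∀ x ∈ I, φ12 x x = 0 := fun x hx => by simp [hφ12 x hx x hx]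
  have h22 : ∀ x ∈ I, φ22 x x = 1 := fun x hx => by simp [hφ22 x hx x hx]
  -- a Wronskian with `φ12 c` that vanishes somewhere forces `φ12 x c = 0`
  have swap : ∀ x ∈ I, ∀ c ∈ I, ∀ y ∈ I, φ12 x y * φ22 c y - φ22 x y * φ12 c y = 0 →
      φ12 x c = 0 := fun x hx c hc y hy h => by
    simpa [h12 c hc, h22 c hc] using
      (sol x hx).wronskian_eq_zero hIconn hA (sol c hc) hy hc h
  have sub : Set.Icc a b ⊆ I := hIconn.out ha hb
  have nonzero : φ22 a b ≠ 0 := by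
    intro h
    have hz : ∀ c ∈ I, φ12 a c = 0 := fun c hc => swap a ha c hc b hb (by simp [h0, h])
    have h1 := (sol a ha).hasDerivAt_fst hI hIconn ha
    have h2 : HasDerivAt (φ12 a) 0 a := (hasDerivAt_const a (0 : ℝ)).congr_of_eventuallyEq (by
      filter_upwards [hI.mem_nhds ha] with c hc using hz c hc)
    simpa [h22 a ha] using h1.unique h2
  have sturm : ∀ c ∈ I, (∀ t ∈ Set.Icc a b, φ12 c t ≠ 0) → False := by
    intro c hc hne
    have := (sol a ha).wronskian_eq_zero_of_forall_ne_zero hI hIconn hA (sol c hc) ha hb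
      hab (h12 a ha) h0 hne ha
    simp [h12 a ha, h22 a ha] at this
    exact hne a (Set.left_mem_Icc.2 hab.le) this
  constructor
  · intro c hc _
    by_contra! hne
    refine sturm c hc fun t ht h => ?_
    rcases ht.2.eq_or_lt with rfl | htb
    · have := (sol a ha).wronskian_eq_zero hIconn hA (sol c hc) hb ha (by simp [h0, h])
      simp [h12 a ha, h22 a ha] at this
      exact hne a ⟨le_rfl, hab⟩ this
    · exact hne t ⟨ht.1, htb⟩ h
  · intro c hc _
    have back : ∀ t ∈ Set.Icc a b, φ12 c t = 0 → φ12 t c = 0 := fun t ht h =>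
      swap t (sub ht) c hc t (sub ht) (by simp [h, h12 t (sub ht)])
    by_contra! hne
    refine sturm c hc fun t ht h => ?_
    rcases ht.1.eq_or_lt with rfl | hat
    · have := (sol a ha).wronskian_eq_zero hIconn hA (sol c hc) ha hb (by simp [h12 a ha, h])
      simp [h0, nonzero] at this
      exact hne b ⟨hab, le_rfl⟩ (back b (Set.right_mem_Icc.2 hab.le) this)
    · exact hne t ⟨hat, ht.2⟩ (back t ht h)
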